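/- Let P = ℝ[x_{μν} : 1 ≤ μ < ν ≤ n] with multiplication operators x_{αβ} and derivative operators ∂_{μν} as above, let M̂_{μν} = Σ_{α,β=1}^n x_{αβ} ∘ ψ(K)_{(μν)(αβ)} be the Weyl realization of so(n), and define Λ̂_{μν} = (e^∂)_{μν}, the (μ,ν) entry of the matrix exponential of the n×n matrix of operators ∂ = [∂_{μν}]. Then for all indices: [M̂_{μν}, Λ̂_{ρσ}] = δ_{νρ} Λ̂_{μσ} - δ_{μρ} Λ̂_{νσ} and [Λ̂_{μν}, Λ̂_{ρσ}] = 0; i.e., M̂_{μν} and Λ̂_{μν} realize the orthogonal algebra so(n) extended by quantum angles. -/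

import Mathlib

open MvPolynomial

/-- Index set for the variables `x_{μν}`, `1 ≤ μ < ν ≤ n`. -/
abbrev PairIdx (n : ℕ) := {q : Fin n × Fin n // q.1 < q.2}

/-- The polynomial algebra `P = ℝ[x_{μν} : 1 ≤ μ < ν ≤ n]`. -/
abbrev PolyH (n : ℕ) := MvPolynomial (PairIdx n) ℝ

/-- Kronecker delta. -/
def kd {n : ℕ} (a b : Fin n) : ℝ := if a = b then 1 else 0

/-- The antisymmetric family of variables: `x_{νμ} = -x_{μν}`, `x_{μμ} = 0`. -/
noncomputable def xv {n : ℕ} (μ ν : Fin n) : PolyH n :=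
  if h : μ < ν then X ⟨(μ, ν), h⟩ else if h : ν < μ then - X ⟨(ν, μ), h⟩ else 0

/-- Partial differentiation `∂_{μν}`, antisymmetric: `∂_{νμ} = -∂_{μν}`. -/
noncomputable def dop {n : ℕ} (μ ν : Fin n) : PolyH n → PolyH n := fun p =>
  if h : μ < ν then pderiv ⟨(μ, ν), h⟩ p else if h : ν < μ then - pderiv ⟨(ν, μ), h⟩ p else 0

/-- `K_{(μν)(αβ)} = (1/2)(δ_{μα}∂_{νβ} - δ_{μβ}∂_{να} + δ_{νβ}∂_{μα} - δ_{να}∂_{μβ})`. -/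
noncomputable def Kop {n : ℕ} (μ ν α β : Fin n) : PolyH n → PolyH n := fun p =>
  (1/2 : ℝ) • (kd μ α • dop ν β p - kd μ β • dop ν α p + kd ν β • dop μ α p - kd ν α • dop μ β p)

/-- Powers of `K`. -/
noncomputable def Kpow {n : ℕ} : ℕ → Fin n → Fin n → Fin n → Fin n → (PolyH n → PolyH n)
  | 0 => fun μ ν α β p => ((1/2 : ℝ) * (kd μ α * kd ν β - kd μ β * kd ν α)) • p
  | m+1 => fun μ ν α β p => ∑ θ, ∑ σ, Kop μ ν θ σ (Kpow m θ σ α β p)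

/-- The coefficient `(-1)^k B_k / k!` of `ψ(t) = t/(1-e^{-t})` (`B₁ = -1/2`). -/
noncomputable def bcoef (k : ℕ) : ℝ := (-1 : ℝ)^k * ((bernoulli k : ℚ) : ℝ) / (k.factorial : ℝ)

/-- `ψ(K)_{(μν)(αβ)} = Σ_{k≥0} ((-1)^k B_k/k!)(K^k)_{(μν)(αβ)}`. -/
noncomputable def psiK {n : ℕ} (μ ν α β : Fin n) : PolyH n → PolyH n := fun p =>
  ∑ᶠ k : ℕ, bcoef k • Kpow k μ ν α β p

/-- The Weyl realization `M̂_{μν} = Σ_{α,β} x_{αβ} ∘ ψ(K)_{(μν)(αβ)}` of `so(n)`. -/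
noncomputable def Mhat {n : ℕ} (μ ν : Fin n) : PolyH n → PolyH n := fun p =>
  ∑ α, ∑ β, xv α β * psiK μ ν α β p

/-- Ordinary matrix powers of the `n×n` matrix of operators `∂ = [∂_{μν}]`. -/
noncomputable def dmatpow {n : ℕ} : ℕ → Fin n → Fin n → (PolyH n → PolyH n)
  | 0 => fun μ ν p => kd μ ν • p
  | m+1 => fun μ ν p => ∑ α, dmatpow m μ α (dop α ν p)

/-- The quantum angles `Λ̂_{μν} = (e^∂)_{μν} = Σ_{m≥0}(1/m!)(∂^m)_{μν}`. -/
noncomputable def Lhat {n : ℕ} (μ ν : Fin n) : PolyH n → PolyH n := fun p =>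
  ∑ᶠ m : ℕ, ((m.factorial : ℝ))⁻¹ • dmatpow m μ ν p

section Bernoulli

open Finset

open PowerSeries in
theorem sum_bernoulli_mul_pow_sub_pow {A : Type*} [CommRing A] [Algebra ℚ A] (a b : A) (N : ℕ) :
    ∑ q ∈ antidiagonal (N + 1),
      algebraMap ℚ A ((q.1.factorial : ℚ)⁻¹ * (bernoulli q.2 / q.2.factorial)) *
        ((a ^ q.1 - b ^ q.1) * (a - b) ^ q.2) =
      (a - b) * (algebraMap ℚ A ((N.factorial : ℚ)⁻¹) * b ^ N) := by
  have key : (rescale a (exp A) - rescale b (exp A)) * rescale (a - b) (bernoulliPowerSeries A) =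
      PowerSeries.X * (PowerSeries.C (a - b) * rescale b (exp A)) := by
    have h := congrArg (rescale (a - b)) (bernoulliPowerSeries_mul_exp_sub_one A)
    rw [map_mul, map_sub, map_one, rescale_X] at h
    have h2 := exp_mul_exp_eq_exp_add (a - b) b
    rw [sub_add_cancel] at h2
    rw [← h2]
    linear_combination (rescale b (exp A)) * h
  have h := congrArg (PowerSeries.coeff (N + 1)) key
  rw [PowerSeries.coeff_mul, PowerSeries.coeff_succ_X_mul, PowerSeries.coeff_C_mul] at h
  simp only [map_sub, PowerSeries.coeff_rescale, PowerSeries.coeff_exp, bernoulliPowerSeries,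
    PowerSeries.coeff_mk, one_div] at h
  rw [mul_comm (algebraMap ℚ A _) (b ^ N), ← h]
  refine sum_congr rfl fun q _ => ?_
  rw [map_mul]
  ring

theorem sum_bernoulli_mul_geom_sum₂ {A : Type*} [CommRing A] [IsDomain A] [Algebra ℝ A]
    {a b : A} (hab : a - b ≠ 0) (N : ℕ) :
    ∑ q ∈ antidiagonal (N + 1),
      ((q.1.factorial : ℝ)⁻¹ * (bernoulli q.2 / q.2.factorial)) •
        ((∑ i ∈ range q.1, a ^ i * b ^ (q.1 - 1 - i)) * (a - b) ^ q.2) =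
      (N.factorial : ℝ)⁻¹ • b ^ N := by
  let _ : Algebra ℚ A := Algebra.compHom A (algebraMap ℚ ℝ)
  have hmap (r : ℚ) : algebraMap ℚ A r = algebraMap ℝ A (r : ℝ) := rfl
  apply mul_left_cancel₀ hab
  have h := sum_bernoulli_mul_pow_sub_pow a b N
  simp only [hmap, Rat.cast_mul, Rat.cast_div, Rat.cast_inv, Rat.cast_natCast] at h
  rw [Algebra.smul_def, ← h, mul_sum]
  refine sum_congr rfl fun q _ => ?_
  rw [Algebra.smul_def, ← (Commute.all a b).geom_sum₂_mul]
  ring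

open scoped IsMulCommutative in
theorem Commute.sum_bernoulli_mul_geom_sum₂ {B : Type*} [Ring B] [Algebra ℝ B]
    {a b : B} (hab : Commute a b) (N : ℕ) :
    ∑ q ∈ antidiagonal (N + 1),
      ((q.1.factorial : ℝ)⁻¹ * (bernoulli q.2 / q.2.factorial)) •
        ((∑ i ∈ range q.1, a ^ i * b ^ (q.1 - 1 - i)) * (a - b) ^ q.2) =
      (N.factorial : ℝ)⁻¹ • b ^ N := by
  have hcomm : ∀ x ∈ ({a, b} : Set B), ∀ y ∈ ({a, b} : Set B), x * y = y * x := by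
    rintro x (rfl | rfl) y (rfl | rfl)
    exacts [rfl, hab.eq, hab.eq.symm, rfl]
  have := Algebra.isMulCommutative_adjoin ℝ hcomm
  let u : Algebra.adjoin ℝ ({a, b} : Set B) := ⟨a, Algebra.subset_adjoin (by simp)⟩
  let v : Algebra.adjoin ℝ ({a, b} : Set B) := ⟨b, Algebra.subset_adjoin (by simp)⟩
  let f : MvPolynomial (Fin 2) ℝ →ₐ[ℝ] B :=
    (Algebra.adjoin ℝ ({a, b} : Set B)).val.comp (MvPolynomial.aeval ![u, v])
  have hf0 : f (MvPolynomial.X 0) = a := by simp [f, u]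
  have hf1 : f (MvPolynomial.X 1) = b := by simp [f, v]
  have hne : (MvPolynomial.X 0 - MvPolynomial.X 1 : MvPolynomial (Fin 2) ℝ) ≠ 0 :=
    sub_ne_zero.mpr fun h => by simpa using MvPolynomial.X_injective h
  have h := congrArg f (_root_.sum_bernoulli_mul_geom_sum₂ hne N)
  simpa [hf0, hf1] using h

end Bernoulli

section WeylAlgebra

open Finset

variable {n : ℕ} {A : Type*} [Ring A] [Algebra ℝ A]

theorem kd_smul {V : Type*} [AddCommGroup V] [Module ℝ V] (a b : Fin n) (v : V) :
    kd a b • v = if a = b then v else 0 := by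
  simp [kd, ite_smul]

/-- The elementary antisymmetric matrix `E_{αβ} - E_{βα}`. -/
noncomputable def asymUnit (A : Type*) [Ring A] [Algebra ℝ A] (α β : Fin n) :
    Matrix (Fin n) (Fin n) A :=
  Matrix.of fun γ δ => kd γ α • kd δ β • 1 - kd γ β • kd δ α • 1

/-- The entry `K_{(μν)(αβ)}` built from a family `d` of elements of an algebra. -/
noncomputable def kElem (d : Matrix (Fin n) (Fin n) A) (μ ν α β : Fin n) : A :=
  (1/2 : ℝ) • (kd μ α • d ν β - kd μ β • d ν α + kd ν β • d μ α - kd ν α • d μ β)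

/-- The entries of the powers of `K`. -/
noncomputable def kPow (d : Matrix (Fin n) (Fin n) A) : ℕ → Fin n → Fin n → Fin n → Fin n → A
  | 0 => fun μ ν α β => ((1/2 : ℝ) * (kd μ α * kd ν β - kd μ β * kd ν α)) • 1
  | m+1 => fun μ ν α β => ∑ θ, ∑ σ, kElem d μ ν θ σ * kPow d m θ σ α β

open LinearMap in
/-- The commutator with the matrix `d`. -/
noncomputable def matAd (d : Matrix (Fin n) (Fin n) A) :
    Module.End ℝ (Matrix (Fin n) (Fin n) A) :=
  mulLeft ℝ d - mulRight ℝ d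

open LinearMap in
/-- The map `T ↦ ∑_{i+j=m-1} d^i T d^j`. -/
noncomputable def powDeriv (d : Matrix (Fin n) (Fin n) A) (m : ℕ) :
    Module.End ℝ (Matrix (Fin n) (Fin n) A) :=
  ∑ i ∈ range m, mulLeft ℝ d ^ i * mulRight ℝ d ^ (m - 1 - i)

section Commute

variable {d : Matrix (Fin n) (Fin n) A} {z : A}

theorem commute_kElem (hz : ∀ μ ν, Commute z (d μ ν)) (μ ν α β : Fin n) :
    Commute z (kElem d μ ν α β) := by
  unfold kElem
  refine Commute.smul_right (Commute.sub_right (Commute.add_right (Commute.sub_right ?_ ?_) ?_)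
    ?_) _ <;> exact (hz _ _).smul_right _

theorem commute_kPow (hz : ∀ μ ν, Commute z (d μ ν)) (k : ℕ) (μ ν α β : Fin n) :
    Commute z (kPow d k μ ν α β) := by
  induction k generalizing μ ν with
  | zero => exact (Commute.one_right z).smul_right _
  | succ k ih =>
    exact Commute.sum_right _ _ _ fun θ _ => Commute.sum_right _ _ _ fun σ _ =>
      (commute_kElem hz _ _ _ _).mul_right (ih _ _)

omit [Algebra ℝ A] in
theorem commute_matrix_pow_apply (hz : ∀ μ ν, Commute z (d μ ν)) (m : ℕ) (μ ν : Fin n) :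
    Commute z ((d ^ m) μ ν) := by
  induction m generalizing ν with
  | zero => by_cases h : μ = ν <;> simp [h]
  | succ m ih =>
    rw [pow_succ, Matrix.mul_apply]
    exact Commute.sum_right _ _ _ fun α _ => (ih α).mul_right (hz _ _)

omit [Algebra ℝ A] in
theorem commute_matrix_scalar (hz : ∀ μ ν, Commute z (d μ ν)) :
    Commute d (Matrix.scalar (Fin n) z) := by
  ext1 μ ν
  simp [(hz μ ν).eq]

variable {Z : Matrix (Fin n) (Fin n) A}

theorem commute_matAd_mulRight (hZ : Commute d Z) :
    Commute (matAd d) (LinearMap.mulRight ℝ Z) :=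
  Commute.sub_left (LinearMap.commute_mulLeft_right (R := ℝ) _ _) <|
    LinearMap.ext fun T => by simp [mul_assoc, hZ.eq]

theorem commute_powDeriv_mulRight (hZ : Commute d Z) (m : ℕ) :
    Commute (powDeriv d m) (LinearMap.mulRight ℝ Z) :=
  Commute.sum_left _ _ _ fun i _ =>
    ((LinearMap.commute_mulLeft_right (R := ℝ) _ _).pow_left _).mul_left <| Commute.pow_left
      (LinearMap.ext fun T => by simp [mul_assoc, hZ.eq]) _

end Commute

theorem powDeriv_matAd (d : Matrix (Fin n) (Fin n) A) (m : ℕ) (T : Matrix (Fin n) (Fin n) A) :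
    powDeriv d m (matAd d T) = d ^ m * T - T * d ^ m := by
  have h := congrArg (fun f => f T)
    ((LinearMap.commute_mulLeft_right (R := ℝ) d d).geom_sum₂_mul m)
  rw [LinearMap.pow_mulLeft, LinearMap.pow_mulRight] at h
  exact h

theorem sum_asymUnit_mul_kElem {d : Matrix (Fin n) (Fin n) A} (hd : ∀ μ ν, d ν μ = -d μ ν)
    (μ ν : Fin n) :
    ∑ θ, ∑ σ, asymUnit A θ σ * Matrix.scalar (Fin n) (kElem d μ ν θ σ) =
      -matAd d (asymUnit A μ ν) := by
  ext1 γ δ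
  simp only [Matrix.sum_apply, Matrix.scalar_apply, Matrix.mul_diagonal]
  simp only [asymUnit, matAd, Matrix.of_apply, LinearMap.sub_apply, LinearMap.mulLeft_apply,
    LinearMap.mulRight_apply, Matrix.neg_apply, Matrix.sub_apply, Matrix.mul_apply,
    mul_sub, sub_mul, sum_sub_distrib, smul_mul_assoc, mul_smul_comm, one_mul, mul_one]
  simp only [kd_smul, sum_ite_eq, sum_ite_eq', mem_univ, if_true, Finset.sum_ite_irrel,
    sum_const_zero]
  simp only [kElem, kd_smul, hd μ γ, hd ν γ, @eq_comm _ δ, @eq_comm _ γ]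
  split_ifs <;> module

theorem sum_asymUnit_mul_kPow {d : Matrix (Fin n) (Fin n) A} (hd : ∀ μ ν, d ν μ = -d μ ν)
    (hc : ∀ μ ν α β, Commute (d μ ν) (d α β)) (k : ℕ) (μ ν : Fin n) :
    ∑ α, ∑ β, asymUnit A α β * Matrix.scalar (Fin n) (kPow d k μ ν α β) =
      (-1 : ℝ) ^ k • (matAd d ^ k) (asymUnit A μ ν) := by
  induction k generalizing μ ν with
  | zero =>
    ext1 γ δ
    simp only [Matrix.sum_apply, Matrix.scalar_apply, Matrix.mul_diagonal]
    simp only [asymUnit, kPow, Matrix.of_apply, sub_mul, smul_mul_assoc, one_mul,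
      sum_sub_distrib, sub_smul, mul_smul, mul_sub, pow_zero, one_smul, Module.End.one_apply]
    simp only [kd_smul, sum_ite_eq, mem_univ, if_true, Finset.sum_ite_irrel,
      sum_const_zero]
    simp only [@eq_comm _ γ, @eq_comm _ δ, ← ite_and, and_comm]
    split_ifs <;> module
  | succ k ih =>
    have hK (θ σ : Fin n) : Commute d (Matrix.scalar (Fin n) (kElem d μ ν θ σ)) :=
      commute_matrix_scalar fun a b => (commute_kElem (hc a b) μ ν θ σ).symm
    have hKK (θ σ α β : Fin n) : Commute (kElem d μ ν θ σ) (kPow d k θ σ α β) :=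
      commute_kPow (fun a b => (commute_kElem (hc a b) _ _ _ _).symm) _ _ _ _ _
    calc ∑ α, ∑ β, asymUnit A α β * Matrix.scalar (Fin n) (kPow d (k + 1) μ ν α β)
        = ∑ α, ∑ β, ∑ θ, ∑ σ, asymUnit A α β * Matrix.scalar (Fin n) (kPow d k θ σ α β) *
            Matrix.scalar (Fin n) (kElem d μ ν θ σ) := by
          simp only [kPow, map_sum, mul_sum, (hKK _ _ _ _).eq, map_mul, mul_assoc]
      _ = ∑ θ, ∑ σ, (∑ α, ∑ β, asymUnit A α β * Matrix.scalar (Fin n) (kPow d k θ σ α β)) *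
            Matrix.scalar (Fin n) (kElem d μ ν θ σ) := by
          simp only [sum_mul]
          simp_rw [← Fintype.sum_prod_type']
          exact Fintype.sum_equiv ((Equiv.prodAssoc _ _ _).symm.trans
            ((Equiv.prodComm _ _).trans (Equiv.prodAssoc _ _ _))) _ _ fun _ => rfl
      _ = (-1 : ℝ) ^ k • (matAd d ^ k)
            (∑ θ, ∑ σ, asymUnit A θ σ * Matrix.scalar (Fin n) (kElem d μ ν θ σ)) := by
          simp only [ih, map_sum, smul_sum, smul_mul_assoc]
          refine sum_congr rfl fun θ _ => sum_congr rfl fun σ _ => congrArg _ ?_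
          exact congrArg (fun f => f (asymUnit A θ σ))
            ((commute_matAd_mulRight (hK θ σ)).pow_left k).eq.symm
      _ = _ := by
          rw [sum_asymUnit_mul_kElem hd, map_neg, pow_succ, pow_succ, Module.End.mul_apply,
            mul_neg_one, smul_neg, neg_smul]

/-- Truncation of `∑ d^m / m!`. -/
noncomputable def expTrunc (d : Matrix (Fin n) (Fin n) A) (N : ℕ) : Matrix (Fin n) (Fin n) A :=
  ∑ m ∈ range N, (m.factorial : ℝ)⁻¹ • d ^ m

/-- Truncation of `ψ(K)_{(μν)(αβ)}`. -/
noncomputable def psiTrunc (d : Matrix (Fin n) (Fin n) A) (N : ℕ) (μ ν α β : Fin n) : A :=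
  ∑ k ∈ range N, bcoef k • kPow d k μ ν α β

theorem bcoef_mul_neg_one_pow (k : ℕ) :
    bcoef k * (-1) ^ k = (bernoulli k : ℝ) / k.factorial := by
  have h : ((-1 : ℝ) ^ k) * (-1) ^ k = 1 := by rw [← mul_pow]; simp
  unfold bcoef
  linear_combination ((bernoulli k : ℝ) / k.factorial) * h

theorem sum_asymUnit_mul_psiTrunc {d : Matrix (Fin n) (Fin n) A} (hd : ∀ μ ν, d ν μ = -d μ ν)
    (hc : ∀ μ ν α β, Commute (d μ ν) (d α β)) (N : ℕ) (μ ν : Fin n) :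
    ∑ α, ∑ β, asymUnit A α β * Matrix.scalar (Fin n) (psiTrunc d N μ ν α β) =
      ∑ k ∈ range N, ((bernoulli k : ℝ) / k.factorial) • (matAd d ^ k) (asymUnit A μ ν) := by
  have hs (r : ℝ) (a : A) : Matrix.scalar (Fin n) (r • a) = r • Matrix.scalar (Fin n) a :=
    Matrix.diagonal_smul r fun _ => a
  simp only [← bcoef_mul_neg_one_pow, mul_smul, ← sum_asymUnit_mul_kPow hd hc, psiTrunc, map_sum,
    hs, mul_sum, mul_smul_comm, smul_sum]
  rw [sum_comm]
  simp_rw [sum_comm (s := range N)]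
  rw [sum_comm]

theorem expTrunc_mul_sub_mul {d : Matrix (Fin n) (Fin n) A} {x : A} {T : Matrix (Fin n) (Fin n) A}
    (hx : ∀ γ δ, d γ δ * x - x * d γ δ = T γ δ) (N : ℕ) (ρ σ : Fin n) :
    expTrunc d N ρ σ * x - x * expTrunc d N ρ σ =
      (∑ m ∈ range N, (m.factorial : ℝ)⁻¹ • powDeriv d m) T ρ σ := by
  have hT : T = matAd d (Matrix.scalar (Fin n) x) := by
    ext1 γ δ
    simp [matAd, ← hx]
  rw [hT, LinearMap.sum_apply]
  simp only [LinearMap.smul_apply, powDeriv_matAd, expTrunc, Matrix.sum_apply, Matrix.smul_apply,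
    sum_mul, mul_sum, ← sum_sub_distrib, smul_mul_assoc, mul_smul_comm, ← smul_sub]
  simp

theorem commute_expTrunc_apply {d : Matrix (Fin n) (Fin n) A} {z : A}
    (hz : ∀ μ ν, Commute z (d μ ν)) (N : ℕ) (μ ν : Fin n) : Commute z (expTrunc d N μ ν) := by
  simp only [expTrunc, Matrix.sum_apply, Matrix.smul_apply]
  exact Commute.sum_right _ _ _ fun m _ => (commute_matrix_pow_apply hz m μ ν).smul_right _

theorem commute_psiTrunc {d : Matrix (Fin n) (Fin n) A} {z : A}
    (hz : ∀ μ ν, Commute z (d μ ν)) (N : ℕ) (μ ν α β : Fin n) :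
    Commute z (psiTrunc d N μ ν α β) :=
  Commute.sum_right _ _ _ fun k _ => (commute_kPow hz k μ ν α β).smul_right _

theorem expTrunc_mul_weyl_sub {d : Matrix (Fin n) (Fin n) A} (hd : ∀ μ ν, d ν μ = -d μ ν)
    (hc : ∀ μ ν α β, Commute (d μ ν) (d α β)) {x : Fin n → Fin n → A}
    (hx : ∀ α β γ δ, d γ δ * x α β - x α β * d γ δ = asymUnit A α β γ δ)
    (N : ℕ) (μ ν ρ σ : Fin n) :
    expTrunc d N ρ σ * (∑ α, ∑ β, x α β * psiTrunc d N μ ν α β) -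
      (∑ α, ∑ β, x α β * psiTrunc d N μ ν α β) * expTrunc d N ρ σ =
    (∑ m ∈ range N, ∑ k ∈ range N, ((m.factorial : ℝ)⁻¹ * (bernoulli k / k.factorial)) •
      powDeriv d m ((matAd d ^ k) (asymUnit A μ ν))) ρ σ := by
  set F : Module.End ℝ (Matrix (Fin n) (Fin n) A) :=
    ∑ m ∈ range N, (m.factorial : ℝ)⁻¹ • powDeriv d m with hF
  have hψ (α β : Fin n) : Commute (expTrunc d N ρ σ) (psiTrunc d N μ ν α β) :=
    commute_psiTrunc (fun a b => (commute_expTrunc_apply (hc a b) N ρ σ).symm) _ _ _ _ _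
  have hFψ (α β : Fin n) : F (asymUnit A α β) ρ σ * psiTrunc d N μ ν α β =
      F (asymUnit A α β * Matrix.scalar (Fin n) (psiTrunc d N μ ν α β)) ρ σ := by
    have hcomm : Commute F
        (LinearMap.mulRight ℝ (Matrix.scalar (Fin n) (psiTrunc d N μ ν α β))) :=
      Commute.sum_left _ _ _ fun m _ => (commute_powDeriv_mulRight (commute_matrix_scalar
        fun a b => (commute_psiTrunc (hc a b) N μ ν α β).symm) m).smul_left _
    have h := congrArg (fun f => f (asymUnit A α β) ρ σ) hcomm.eq
    simpa using h.symm
  calc _ = ∑ α, ∑ β, (expTrunc d N ρ σ * x α β - x α β * expTrunc d N ρ σ) *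
          psiTrunc d N μ ν α β := by
        simp only [mul_sum, sum_mul, ← sum_sub_distrib, sub_mul, mul_assoc, (hψ _ _).eq]
    _ = F (∑ α, ∑ β, asymUnit A α β * Matrix.scalar (Fin n) (psiTrunc d N μ ν α β)) ρ σ := by
        simp only [expTrunc_mul_sub_mul (hx _ _), ← hF, hFψ, map_sum, Matrix.sum_apply]
    _ = _ := by
        rw [sum_asymUnit_mul_psiTrunc hd hc, hF, LinearMap.sum_apply]
        simp only [LinearMap.smul_apply, map_sum, map_smul, mul_smul]
        exact congrArg (fun T : Matrix (Fin n) (Fin n) A => T ρ σ)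
          (sum_congr rfl fun _ _ => sum_congr rfl fun _ _ => smul_comm _ _ _)

section Filtration

variable {O : ℕ → Submodule ℝ A} [SetLike.GradedMonoid O] {d : Matrix (Fin n) (Fin n) A}

theorem matrix_mul_mem {S T : Matrix (Fin n) (Fin n) A} {a b : ℕ} (hS : ∀ i j, S i j ∈ O a)
    (hT : ∀ i j, T i j ∈ O b) (i j : Fin n) : (S * T) i j ∈ O (a + b) := by
  rw [Matrix.mul_apply]
  exact sum_mem fun l _ => SetLike.mul_mem_graded (hS i l) (hT l j)

theorem matrix_pow_mem (hd : ∀ i j, d i j ∈ O 1) (m : ℕ) (i j : Fin n) : (d ^ m) i j ∈ O m := by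
  induction m generalizing i j with
  | zero =>
    by_cases h : i = j
    · simpa [h] using SetLike.one_mem_graded O
    · simp [h]
  | succ m ih => exact pow_succ d m ▸ matrix_mul_mem ih hd i j

theorem asymUnit_mem (μ ν i j : Fin n) : asymUnit A μ ν i j ∈ O 0 := by
  have h := SetLike.one_mem_graded O
  exact sub_mem ((O 0).smul_mem _ ((O 0).smul_mem _ h)) ((O 0).smul_mem _ ((O 0).smul_mem _ h))

omit [SetLike.GradedMonoid O] in
theorem kElem_mem (hd : ∀ i j, d i j ∈ O 1) (μ ν α β : Fin n) : kElem d μ ν α β ∈ O 1 := by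
  refine (O 1).smul_mem _ (sub_mem (add_mem (sub_mem ?_ ?_) ?_) ?_) <;>
  exact (O 1).smul_mem _ (hd _ _)

theorem kPow_mem (hd : ∀ i j, d i j ∈ O 1) (k : ℕ) (μ ν α β : Fin n) :
    kPow d k μ ν α β ∈ O k := by
  induction k generalizing μ ν with
  | zero => exact (O 0).smul_mem _ (SetLike.one_mem_graded O)
  | succ k ih =>
    exact sum_mem fun θ _ => sum_mem fun σ _ =>
      add_comm 1 k ▸ SetLike.mul_mem_graded (kElem_mem hd _ _ _ _) (ih _ _)

theorem matAd_pow_mem (hd : ∀ i j, d i j ∈ O 1) {T : Matrix (Fin n) (Fin n) A}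
    (hT : ∀ i j, T i j ∈ O 0) (k : ℕ) (i j : Fin n) : (matAd d ^ k) T i j ∈ O k := by
  induction k generalizing i j with
  | zero => exact hT i j
  | succ k ih =>
    rw [pow_succ', Module.End.mul_apply]
    exact sub_mem (add_comm 1 k ▸ matrix_mul_mem hd ih i j) (matrix_mul_mem ih hd i j)

theorem powDeriv_mem (hd : ∀ i j, d i j ∈ O 1) {T : Matrix (Fin n) (Fin n) A} {k : ℕ}
    (hT : ∀ i j, T i j ∈ O k) (m : ℕ) (i j : Fin n) :
    powDeriv d (m + 1) T i j ∈ O (m + k) := by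
  rw [powDeriv, LinearMap.sum_apply, Matrix.sum_apply]
  refine sum_mem fun l hl => ?_
  rw [Module.End.mul_apply, LinearMap.pow_mulLeft, LinearMap.pow_mulRight]
  have h := matrix_mul_mem (matrix_pow_mem hd l)
    (matrix_mul_mem hT (matrix_pow_mem hd (m + 1 - 1 - l))) i j
  have he : l + (k + (m + 1 - 1 - l)) = m + k := by grind
  exact he ▸ h

theorem expTrunc_mul_weyl_sub_mem (hO : Antitone O) (hdO : ∀ i j, d i j ∈ O 1)
    (hd : ∀ μ ν, d ν μ = -d μ ν)
    (hc : ∀ μ ν α β, Commute (d μ ν) (d α β)) {x : Fin n → Fin n → A}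
    (hx : ∀ α β γ δ, d γ δ * x α β - x α β * d γ δ = asymUnit A α β γ δ)
    (N : ℕ) (μ ν ρ σ : Fin n) :
    expTrunc d (N + 1) ρ σ * (∑ α, ∑ β, x α β * psiTrunc d (N + 1) μ ν α β) -
      (∑ α, ∑ β, x α β * psiTrunc d (N + 1) μ ν α β) * expTrunc d (N + 1) ρ σ -
      (asymUnit A μ ν * expTrunc d N) ρ σ ∈ O N := by
  set f : ℕ → ℕ → Matrix (Fin n) (Fin n) A := fun m k =>
    ((m.factorial : ℝ)⁻¹ * (bernoulli k / k.factorial)) •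
      powDeriv d m ((matAd d ^ k) (asymUnit A μ ν)) with hf
  have hlow : ∑ m ∈ range (N + 1), ∑ k ∈ range (N + 1 - m), f m k =
      asymUnit A μ ν * expTrunc d N := by
    rw [← sum_range_diag_flip, sum_range_succ']
    have h0 : ∑ k ∈ range (0 + 1), f k (0 - k) = 0 := by simp [hf, powDeriv]
    rw [h0, add_zero, expTrunc, mul_sum]
    refine sum_congr rfl fun s _ => ?_
    rw [← Nat.sum_antidiagonal_eq_sum_range_succ f]
    have h := congrArg (fun g => g (asymUnit A μ ν))
      ((LinearMap.commute_mulLeft_right (R := ℝ) d d).sum_bernoulli_mul_geom_sum₂ s)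
    rw [LinearMap.pow_mulRight] at h
    simp only [LinearMap.sum_apply] at h
    rw [mul_smul_comm]
    exact h
  have hsplit : ∑ m ∈ range (N + 1), ∑ k ∈ range (N + 1), f m k =
      ∑ m ∈ range (N + 1), ∑ k ∈ range (N + 1 - m), f m k +
        ∑ m ∈ range (N + 1), ∑ k ∈ Ico (N + 1 - m) (N + 1), f m k := by
    rw [← sum_add_distrib]
    exact sum_congr rfl fun m _ => (sum_range_add_sum_Ico _ (Nat.sub_le _ _)).symm
  rw [expTrunc_mul_weyl_sub hd hc hx, hsplit, hlow, Matrix.add_apply, add_sub_cancel_left,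
    Matrix.sum_apply]
  refine sum_mem fun m _ => ?_
  rw [Matrix.sum_apply]
  refine sum_mem fun k hk => (O N).smul_mem _ ?_
  cases m with
  | zero => simp [powDeriv]
  | succ m =>
    exact hO (by grind) (powDeriv_mem hdO (matAd_pow_mem hdO (asymUnit_mem μ ν) k) m ρ σ)

end Filtration

end WeylAlgebra

section WeylRealization

open Finset

variable {n : ℕ}

/-- The derivation underlying `dop`. -/
noncomputable def dopDerivation (μ ν : Fin n) : Derivation ℝ (PolyH n) (PolyH n) :=
  if h : μ < ν then pderiv ⟨(μ, ν), h⟩ else if h : ν < μ then - pderiv ⟨(ν, μ), h⟩ else 0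

theorem dopDerivation_apply (μ ν : Fin n) (p : PolyH n) : dopDerivation μ ν p = dop μ ν p := by
  unfold dopDerivation dop
  split_ifs <;> rfl

theorem dop_swap (μ ν : Fin n) (p : PolyH n) : dop ν μ p = -dop μ ν p := by
  unfold dop
  rcases lt_trichotomy μ ν with h | rfl | h
  · simp [h, h.not_gt]
  · simp
  · simp [h, h.not_gt]

theorem dop_mul (μ ν : Fin n) (p q : PolyH n) :
    dop μ ν (p * q) = p * dop μ ν q + q * dop μ ν p := by
  simp only [← dopDerivation_apply, Derivation.leibniz, smul_eq_mul]

theorem dop_C (μ ν : Fin n) (r : ℝ) : dop μ ν (C r) = 0 := by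
  rw [← dopDerivation_apply]
  exact (dopDerivation μ ν).map_algebraMap r

theorem dop_xv (γ δ α β : Fin n) :
    dop γ δ (xv α β) = C (kd γ α * kd δ β - kd γ β * kd δ α) := by
  unfold dop xv kd
  split_ifs <;> simp_all [pderiv_X, Prod.ext_iff] <;> grind

theorem X_eq_xv (i : PairIdx n) : (X i : PolyH n) = xv i.1.1 i.1.2 := by
  simp [xv, i.2]

theorem dop_comm (μ ν α β : Fin n) (p : PolyH n) :
    dop μ ν (dop α β p) = dop α β (dop μ ν p) := by
  have h : ⁅dopDerivation μ ν, dopDerivation α β⁆ = 0 :=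
    MvPolynomial.derivation_ext fun i => by
      simp only [Derivation.commutator_apply, dopDerivation_apply, X_eq_xv, dop_xv, dop_C, sub_self,
        Derivation.zero_apply]
  have hp := congrArg (fun D => D p) h
  simpa only [Derivation.commutator_apply, dopDerivation_apply, Derivation.zero_apply,
    sub_eq_zero] using hp

/-- The matrix `∂` with entries in the algebra of linear endomorphisms of `P`. -/
noncomputable def dopMatrix (n : ℕ) : Matrix (Fin n) (Fin n) (Module.End ℝ (PolyH n)) :=
  Matrix.of fun μ ν =>
    { toFun := dop μ ν
      map_add' := fun p q => by simp only [← dopDerivation_apply, map_add]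
      map_smul' := fun r p => by
        simp only [← dopDerivation_apply]
        exact (dopDerivation μ ν).map_smul r p }

theorem dopMatrix_swap (μ ν : Fin n) : dopMatrix n ν μ = -dopMatrix n μ ν :=
  LinearMap.ext fun p => dop_swap μ ν p

theorem commute_dopMatrix (μ ν α β : Fin n) : Commute (dopMatrix n μ ν) (dopMatrix n α β) :=
  LinearMap.ext fun p => dop_comm μ ν α β p

theorem dopMatrix_mul_mulLeft_xv_sub (α β γ δ : Fin n) :
    dopMatrix n γ δ * LinearMap.mulLeft ℝ (xv α β) - LinearMap.mulLeft ℝ (xv α β) *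
      dopMatrix n γ δ = asymUnit (Module.End ℝ (PolyH n)) α β γ δ := by
  refine LinearMap.ext fun p => ?_
  change dop γ δ (xv α β * p) - xv α β * dop γ δ p =
    kd γ α • kd δ β • p - kd γ β • kd δ α • p
  rw [dop_mul, dop_xv, add_sub_cancel_left, mul_comm, C_mul', sub_smul, mul_smul, mul_smul]

theorem Kpow_eq (k : ℕ) (μ ν α β : Fin n) (p : PolyH n) :
    Kpow k μ ν α β p = kPow (dopMatrix n) k μ ν α β p := by
  induction k generalizing μ ν with
  | zero => rfl
  | succ k ih =>
    simp only [Kpow, kPow, LinearMap.sum_apply, Module.End.mul_apply, ih]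
    rfl

theorem dmatpow_eq (m : ℕ) (μ ν : Fin n) (p : PolyH n) :
    dmatpow m μ ν p = (dopMatrix n ^ m) μ ν p := by
  induction m generalizing ν p with
  | zero =>
    simp only [dmatpow, kd_smul, pow_zero, Matrix.one_apply]
    split_ifs <;> rfl
  | succ m ih =>
    simp only [dmatpow, pow_succ, Matrix.mul_apply, LinearMap.sum_apply, ih]
    rfl

/-- Polynomials killed by every composition of `k` derivatives. -/
noncomputable def dopFiltration (n : ℕ) : ℕ → Submodule ℝ (PolyH n)
  | 0 => ⊥
  | k + 1 => ⨅ μ, ⨅ ν, (dopFiltration n k).comap (dopMatrix n μ ν)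

theorem mem_dopFiltration_succ {k : ℕ} {p : PolyH n} :
    p ∈ dopFiltration n (k + 1) ↔ ∀ μ ν, dop μ ν p ∈ dopFiltration n k := by
  simp only [dopFiltration, Submodule.mem_iInf]
  rfl

theorem mem_dopFiltration_zero {p : PolyH n} : p ∈ dopFiltration n 0 ↔ p = 0 :=
  Submodule.mem_bot ℝ

theorem monotone_dopFiltration : Monotone (dopFiltration n) := by
  refine monotone_nat_of_le_succ fun k => ?_
  induction k with
  | zero => exact bot_le
  | succ k ih =>
    intro p hp
    rw [mem_dopFiltration_succ] at hp ⊢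
    exact fun μ ν => ih (hp μ ν)

theorem mul_X_mem_dopFiltration {k : ℕ} {p : PolyH n} (hp : p ∈ dopFiltration n k)
    (i : PairIdx n) : p * X i ∈ dopFiltration n (k + 1) := by
  induction k generalizing p with
  | zero =>
    rw [mem_dopFiltration_zero.mp hp, zero_mul]
    exact zero_mem _
  | succ k ih =>
    refine mem_dopFiltration_succ.mpr fun μ ν => ?_
    rw [dop_mul, X_eq_xv, dop_xv, ← X_eq_xv, mul_comm p, C_mul', mul_comm (X i)]
    exact add_mem (Submodule.smul_mem _ _ hp) (ih (mem_dopFiltration_succ.mp hp μ ν))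

theorem exists_mem_dopFiltration (p : PolyH n) : ∃ k, p ∈ dopFiltration n k := by
  induction p using MvPolynomial.induction_on with
  | C r =>
    refine ⟨1, mem_dopFiltration_succ.mpr fun μ ν => ?_⟩
    rw [dop_C]
    exact zero_mem _
  | add p q hp hq =>
    obtain ⟨k, hk⟩ := hp
    obtain ⟨l, hl⟩ := hq
    exact ⟨max k l, add_mem (monotone_dopFiltration (le_max_left k l) hk)
      (monotone_dopFiltration (le_max_right k l) hl)⟩
  | mul_X p i hp =>
    obtain ⟨k, hk⟩ := hp
    exact ⟨k + 1, mul_X_mem_dopFiltration hk i⟩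

/-- Operators lowering the filtration by at least `k`. -/
def orderFiltration (n k : ℕ) : Submodule ℝ (Module.End ℝ (PolyH n)) where
  carrier := {z | ∀ j, ∀ p ∈ dopFiltration n j, z p ∈ dopFiltration n (j - k)}
  add_mem' hy hz j p hp := add_mem (hy j p hp) (hz j p hp)
  zero_mem' _ _ _ := zero_mem _
  smul_mem' r _ hz j p hp := Submodule.smul_mem _ r (hz j p hp)

instance : SetLike.GradedMonoid (orderFiltration n) where
  one_mem _ _ hp := hp
  mul_mem a b y z hy hz j p hp := by
    have h := hy _ _ (hz j p hp)
    rwa [Nat.sub_sub, add_comm] at h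

theorem antitone_orderFiltration : Antitone (orderFiltration n) := fun _ _ hkl _ hz j p hp =>
  monotone_dopFiltration (Nat.sub_le_sub_left hkl j) (hz j p hp)

theorem dopMatrix_mem_orderFiltration (μ ν : Fin n) : dopMatrix n μ ν ∈ orderFiltration n 1 := by
  intro j p hp
  cases j with
  | zero =>
    rw [mem_dopFiltration_zero.mp hp, map_zero]
    exact zero_mem _
  | succ j => exact mem_dopFiltration_succ.mp hp μ ν

theorem apply_eq_zero_of_mem_orderFiltration {N k : ℕ} {z : Module.End ℝ (PolyH n)} {p : PolyH n}
    (hz : z ∈ orderFiltration n k) (hp : p ∈ dopFiltration n N) (hk : N ≤ k) : z p = 0 := by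
  have h := hz N p hp
  rwa [Nat.sub_eq_zero_of_le hk, mem_dopFiltration_zero] at h

theorem finsum_eq_sum_range {M : Type*} [AddCommMonoid M] {f : ℕ → M} {N : ℕ}
    (hf : ∀ k, N ≤ k → f k = 0) : ∑ᶠ k, f k = ∑ k ∈ range N, f k :=
  finsum_eq_sum_of_support_subset _ fun k hk => by
    by_contra h
    exact hk (hf k (by simpa using h))

theorem Lhat_eq_expTrunc {N : ℕ} {p : PolyH n} (hp : p ∈ dopFiltration n N) (μ ν : Fin n) :
    Lhat μ ν p = expTrunc (dopMatrix n) N μ ν p := by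
  rw [Lhat, finsum_eq_sum_range (N := N) fun m hm => ?_]
  · simp only [dmatpow_eq, expTrunc, Matrix.sum_apply, LinearMap.sum_apply]
    rfl
  · rw [dmatpow_eq, apply_eq_zero_of_mem_orderFiltration
      (matrix_pow_mem dopMatrix_mem_orderFiltration m μ ν) hp hm, smul_zero]

theorem psiK_eq_psiTrunc {N : ℕ} {p : PolyH n} (hp : p ∈ dopFiltration n N)
    (μ ν α β : Fin n) : psiK μ ν α β p = psiTrunc (dopMatrix n) N μ ν α β p := by
  rw [psiK, finsum_eq_sum_range (N := N) fun k hk => ?_]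
  · simp only [Kpow_eq, psiTrunc, LinearMap.sum_apply]
    rfl
  · rw [Kpow_eq, apply_eq_zero_of_mem_orderFiltration
      (kPow_mem dopMatrix_mem_orderFiltration k μ ν α β) hp hk, smul_zero]

theorem Mhat_eq_sum {N : ℕ} {p : PolyH n} (hp : p ∈ dopFiltration n N) (μ ν : Fin n) :
    Mhat μ ν p = (∑ α, ∑ β, LinearMap.mulLeft ℝ (xv α β) *
      psiTrunc (dopMatrix n) N μ ν α β : Module.End ℝ (PolyH n)) p := by
  simp only [Mhat, psiK_eq_psiTrunc hp, LinearMap.sum_apply]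
  rfl

theorem expTrunc_dopMatrix_mem (M N : ℕ) {p : PolyH n} (hp : p ∈ dopFiltration n N)
    (μ ν : Fin n) : expTrunc (dopMatrix n) M μ ν p ∈ dopFiltration n N := by
  have h : expTrunc (dopMatrix n) M μ ν ∈ orderFiltration n 0 := by
    rw [expTrunc, Matrix.sum_apply]
    exact sum_mem fun m _ => Submodule.smul_mem _ _ <| antitone_orderFiltration (Nat.zero_le m)
      (matrix_pow_mem dopMatrix_mem_orderFiltration m μ ν)
  exact h N p hp

theorem asymUnit_mul_apply {A : Type*} [Ring A] [Algebra ℝ A] (T : Matrix (Fin n) (Fin n) A)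
    (μ ν ρ σ : Fin n) :
    (asymUnit A μ ν * T) ρ σ = kd ρ μ • T ν σ - kd ρ ν • T μ σ := by
  simp only [asymUnit, Matrix.mul_apply, Matrix.of_apply, sub_mul, smul_mul_assoc, one_mul,
    sum_sub_distrib]
  simp only [kd_smul, sum_ite_eq', mem_univ, if_true, Finset.sum_ite_irrel, sum_const_zero]

theorem kd_comm (a b : Fin n) : kd a b = kd b a := by
  simp only [kd, eq_comm]

theorem Mhat_Lhat_sub (μ ν ρ σ : Fin n) (p : PolyH n) :
    Mhat μ ν (Lhat ρ σ p) - Lhat ρ σ (Mhat μ ν p) =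
      kd ν ρ • Lhat μ σ p - kd μ ρ • Lhat ν σ p := by
  obtain ⟨k, hk⟩ := exists_mem_dopFiltration p
  obtain ⟨l, hl⟩ := exists_mem_dopFiltration (Mhat μ ν p)
  set N := max k l
  have hp : p ∈ dopFiltration n N := monotone_dopFiltration (le_max_left k l) hk
  have hM : Mhat μ ν p ∈ dopFiltration n (N + 1) :=
    monotone_dopFiltration ((le_max_right k l).trans (Nat.le_succ N)) hl
  have hp' : p ∈ dopFiltration n (N + 1) := monotone_dopFiltration (Nat.le_succ N) hp
  have h := apply_eq_zero_of_mem_orderFiltration (expTrunc_mul_weyl_sub_mem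
    antitone_orderFiltration dopMatrix_mem_orderFiltration dopMatrix_swap commute_dopMatrix
    dopMatrix_mul_mulLeft_xv_sub N μ ν ρ σ) hp le_rfl
  rw [asymUnit_mul_apply, kd_comm ρ, kd_comm ρ] at h
  rw [Lhat_eq_expTrunc hM, Lhat_eq_expTrunc hp', Lhat_eq_expTrunc hp, Lhat_eq_expTrunc hp,
    Mhat_eq_sum (expTrunc_dopMatrix_mem (N + 1) (N + 1) hp' ρ σ), Mhat_eq_sum hp']
  refine neg_injective ?_
  rw [neg_sub, neg_sub]
  exact sub_eq_zero.mp h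

theorem Lhat_comm (μ ν ρ σ : Fin n) (p : PolyH n) :
    Lhat μ ν (Lhat ρ σ p) = Lhat ρ σ (Lhat μ ν p) := by
  obtain ⟨N, hp⟩ := exists_mem_dopFiltration p
  rw [Lhat_eq_expTrunc hp, Lhat_eq_expTrunc hp,
    Lhat_eq_expTrunc (expTrunc_dopMatrix_mem N N hp ρ σ),
    Lhat_eq_expTrunc (expTrunc_dopMatrix_mem N N hp μ ν)]
  exact congrArg (fun f => f p) (commute_expTrunc_apply (fun a b =>
    (commute_expTrunc_apply (fun c d => commute_dopMatrix a b c d) N μ ν).symm) N ρ σ).eq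

end WeylRealization

/-- Theorem 3: `M̂_{μν}` and `Λ̂_{μν}` realize the orthogonal algebra
`so(n)` extended by quantum angles:
`[M̂_{μν},Λ̂_{ρσ}] = δ_{νρ}Λ̂_{μσ} - δ_{μρ}Λ̂_{νσ}` and `[Λ̂_{μν},Λ̂_{ρσ}] = 0`. -/
theorem statement16 (n : ℕ) (hn : 2 ≤ n) :
    (∀ μ ν ρ σ : Fin n,
      Mhat μ ν ∘ Lhat ρ σ - Lhat ρ σ ∘ Mhat μ ν
        = kd ν ρ • Lhat μ σ - kd μ ρ • Lhat ν σ) ∧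
    (∀ μ ν ρ σ : Fin n,
      Lhat μ ν ∘ Lhat ρ σ - Lhat ρ σ ∘ Lhat μ ν = 0) := by
  exact ⟨fun μ ν ρ σ => funext fun p => Mhat_Lhat_sub μ ν ρ σ p,
    fun μ ν ρ σ => funext fun p => sub_eq_zero.mpr (Lhat_comm μ ν ρ σ p)⟩
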